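/- arXiv:math/0601262 — 2 statements merged into one kernel-verified Lean document; each statement's English description precedes it below -/
import Mathlib

section
/- A 4×4 complex matrix X satisfying X·γ₀ = γ₀·X, X·γ_i = -γ_i·X for i = 1,2,3 and X² = 1 is necessarily X = γ₀ or X = -γ₀; and a 4×4 complex matrix Y satisfying Y·γ₀ = -γ₀·Y, Y·γ_i = γ_i·Y for i = 1,2,3 and Y² = 1 is necessarily Y = γ₁γ₂γ₃ or Y = -γ₁γ₂γ₃. -/
open Matrix Complex

noncomputable section

/-- The Pauli matrices σ₀, σ₁, σ₂, σ₃. -/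
def Pauli : Fin 4 → Matrix (Fin 2) (Fin 2) ℂ :=
  ![!![1, 0; 0, 1], !![0, 1; 1, 0], !![0, -I; I, 0], !![1, 0; 0, -1]]

/-- The tilde Pauli matrices: σ̃₀ = σ₀ and σ̃ₘ = -σₘ for m = 1,2,3. -/
def PauliT : Fin 4 → Matrix (Fin 2) (Fin 2) ℂ :=
  ![!![1, 0; 0, 1], -!![0, 1; 1, 0], -!![0, -I; I, 0], -!![1, 0; 0, -1]]

/-- The Dirac matrices γₘ = [[0, σₘ],[σ̃ₘ, 0]] in 2×2-block form, written out as 4×4 matrices. -/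
def Dirac : Fin 4 → Matrix (Fin 4) (Fin 4) ℂ :=
  ![!![0, 0, 1, 0; 0, 0, 0, 1; 1, 0, 0, 0; 0, 1, 0, 0],
    !![0, 0, 0, 1; 0, 0, 1, 0; 0, -1, 0, 0; -1, 0, 0, 0],
    !![0, 0, 0, -I; 0, 0, I, 0; 0, I, 0, 0; -I, 0, 0, 0],
    !![0, 0, 1, 0; 0, 0, 0, -1; -1, 0, 0, 0; 0, 1, 0, 0]]

/-- The Minkowski metric matrix g = diag(1,-1,-1,-1). -/
def etaMink : Matrix (Fin 4) (Fin 4) ℝ := !![1,0,0,0; 0,-1,0,0; 0,0,-1,0; 0,0,0,-1]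

/-- The defining relation of the homomorphism φ: 𝔖 σₘ 𝔖† = Σₖ Sᵏₘ σₖ. -/
def IsPhi (𝔖 : Matrix (Fin 2) (Fin 2) ℂ) (S : Matrix (Fin 4) (Fin 4) ℝ) : Prop :=
  ∀ m : Fin 4, 𝔖 * Pauli m * 𝔖ᴴ = ∑ k : Fin 4, (S k m : ℂ) • Pauli k

/-- The block-diagonal matrix Ŝ = diag(𝔖, (𝔖⁻¹)†). -/
def hatM (A : Matrix (Fin 2) (Fin 2) ℂ) : Matrix (Fin 4) (Fin 4) ℂ :=
  !![A 0 0, A 0 1, 0, 0;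
     A 1 0, A 1 1, 0, 0;
     0, 0, ((A⁻¹)ᴴ) 0 0, ((A⁻¹)ᴴ) 0 1;
     0, 0, ((A⁻¹)ᴴ) 1 0, ((A⁻¹)ᴴ) 1 1]

lemma Dirac_zero_mul_self : Dirac 0 * Dirac 0 = 1 := by
  ext i j
  fin_cases i <;> fin_cases j <;> simp [Dirac, Matrix.mul_apply, Fin.sum_univ_four]

lemma Dirac_one_mul_two_mul_three :
    Dirac 1 * Dirac 2 * Dirac 3 =
      !![0, 0, -I, 0; 0, 0, 0, -I; I, 0, 0, 0; 0, I, 0, 0] := by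
  ext i j
  fin_cases i <;> fin_cases j <;> simp [Dirac, Matrix.mul_apply, Fin.sum_univ_four]

lemma Dirac_one_two_three_mul_self :
    (Dirac 1 * Dirac 2 * Dirac 3) * (Dirac 1 * Dirac 2 * Dirac 3) = 1 := by
  rw [Dirac_one_mul_two_mul_three]
  ext i j
  fin_cases i <;> fin_cases j <;> simp [Matrix.mul_apply, Fin.sum_univ_four]

lemma Dirac_one_two_three_anticomm_zero :
    Dirac 1 * Dirac 2 * Dirac 3 * Dirac 0 = -(Dirac 0 * (Dirac 1 * Dirac 2 * Dirac 3)) := by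
  rw [Dirac_one_mul_two_mul_three]
  ext i j
  fin_cases i <;> fin_cases j <;> simp [Dirac, Matrix.mul_apply, Fin.sum_univ_four]

lemma Dirac_one_two_three_comm_succ (m : Fin 3) :
    Commute (Dirac 1 * Dirac 2 * Dirac 3) (Dirac m.succ) := by
  rw [Dirac_one_mul_two_mul_three, commute_iff_eq]
  ext i j
  fin_cases m <;> fin_cases i <;> fin_cases j <;>
    simp [Dirac, Matrix.mul_apply, Fin.sum_univ_four]

lemma Dirac_zero_anticomm_succ (m : Fin 3) :
    Dirac 0 * Dirac m.succ = -(Dirac m.succ * Dirac 0) := by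
  ext i j
  fin_cases m <;> fin_cases i <;> fin_cases j <;>
    simp [Dirac, Matrix.mul_apply, Fin.sum_univ_four]

/-- The Dirac matrices act irreducibly: their commutant consists of the scalar matrices. -/
lemma eq_smul_one_of_commute_Dirac {M : Matrix (Fin 4) (Fin 4) ℂ}
    (h : ∀ m, Commute M (Dirac m)) : M = M 0 0 • (1 : Matrix (Fin 4) (Fin 4) ℂ) := by
  have e (m i j : Fin 4) : (M * Dirac m) i j = (Dirac m * M) i j := by rw [(h m).eq]
  have e0 := e 0
  have e1 := e 1
  have e2 : M 0 3 = M 3 0 := by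
    simpa [Dirac, Matrix.mul_apply, Fin.sum_univ_four, mul_comm] using e 2 0 0
  have e3 := e 3
  simp [Fin.forall_fin_succ, Dirac, Matrix.mul_apply, Fin.sum_univ_four] at e0 e1 e3
  ext i j
  fin_cases i <;> fin_cases j <;> simp <;> grind

/-- Two involutions whose product commutes with all Dirac matrices agree up to sign. -/
lemma eq_or_eq_neg_of_commute_mul_Dirac {X G : Matrix (Fin 4) (Fin 4) ℂ}
    (hX : X * X = 1) (hG : G * G = 1) (h : ∀ m, Commute (X * G) (Dirac m)) :
    X = G ∨ X = -G := by
  obtain ⟨c, hc⟩ : ∃ c : ℂ, X * G = c • 1 := ⟨_, eq_smul_one_of_commute_Dirac h⟩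
  have hXG : X = c • G := by
    rw [← mul_one X, ← hG, ← mul_assoc, hc, smul_mul_assoc, one_mul]
  have hc2 : c * c = 1 := by
    have h00 := congrFun₂ hX 0 0
    rw [hXG, smul_mul_smul_comm, hG] at h00
    simpa using h00
  rcases mul_self_eq_one_iff.mp hc2 with rfl | rfl
  · exact Or.inl (by simpa using hXG)
  · exact Or.inr (by simpa using hXG)

/-- With the normalization X² = 1 (resp. Y² = 1), the solutions of the P-
(resp. T-) commutation equations are exactly ±γ₀ (resp. ±γ₁γ₂γ₃). -/
theorem stmt10 :
    (∀ X : Matrix (Fin 4) (Fin 4) ℂ,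
      X * Dirac 0 = Dirac 0 * X →
      X * Dirac 1 = -(Dirac 1 * X) →
      X * Dirac 2 = -(Dirac 2 * X) →
      X * Dirac 3 = -(Dirac 3 * X) →
      X * X = 1 →
      X = Dirac 0 ∨ X = -Dirac 0) ∧
    (∀ Y : Matrix (Fin 4) (Fin 4) ℂ,
      Y * Dirac 0 = -(Dirac 0 * Y) →
      Y * Dirac 1 = Dirac 1 * Y →
      Y * Dirac 2 = Dirac 2 * Y →
      Y * Dirac 3 = Dirac 3 * Y →
      Y * Y = 1 →
      Y = Dirac 1 * Dirac 2 * Dirac 3 ∨ Y = -(Dirac 1 * Dirac 2 * Dirac 3)) := by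
  refine ⟨fun X h0 h1 h2 h3 hX => ?_, fun Y h0 h1 h2 h3 hY => ?_⟩
  · refine eq_or_eq_neg_of_commute_mul_Dirac hX Dirac_zero_mul_self (Fin.cases ?_ fun m => ?_)
    · exact (show Commute X (Dirac 0) from h0).mul_left (Commute.refl _)
    · have hm : X * Dirac m.succ = -(Dirac m.succ * X) := by
        fin_cases m
        exacts [h1, h2, h3]
      rw [commute_iff_eq, mul_assoc, Dirac_zero_anticomm_succ, mul_neg, ← mul_assoc, hm,
        neg_mul, neg_neg, mul_assoc]
  · refine eq_or_eq_neg_of_commute_mul_Dirac hY Dirac_one_two_three_mul_self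
      (Fin.cases ?_ fun m => ?_)
    · rw [commute_iff_eq, mul_assoc, Dirac_one_two_three_anticomm_zero, mul_neg, ← mul_assoc, h0,
        neg_mul, neg_neg, mul_assoc]
    · have hm : Commute Y (Dirac m.succ) := by
        fin_cases m
        exacts [h1, h2, h3]
      exact hm.mul_left (Dirac_one_two_three_comm_succ m)
end
end

section
/- Every matrix Ŝ in the full Lorentz group O(1,3,ℝ) can be written in exactly one of the four forms Ŝ = S, Ŝ = P·S, Ŝ = T·S, or Ŝ = -S, where S ∈ SO⁺(1,3,ℝ), P = diag(1,-1,-1,-1) is the spatial inversion matrix, and T = diag(-1,1,1,1) is the time inversion matrix; i.e., O(1,3,ℝ) is the disjoint union of the four cosets SO⁺(1,3,ℝ), P·SO⁺(1,3,ℝ), T·SO⁺(1,3,ℝ), and -SO⁺(1,3,ℝ). -/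
open Matrix Complex

noncomputable section

/-- The spatial inversion matrix P = diag(1,-1,-1,-1). -/
def Pmat : Matrix (Fin 4) (Fin 4) ℝ := !![1,0,0,0; 0,-1,0,0; 0,0,-1,0; 0,0,0,-1]

/-- The time inversion matrix T = diag(-1,1,1,1). -/
def Tmat : Matrix (Fin 4) (Fin 4) ℝ := !![-1,0,0,0; 0,1,0,0; 0,0,1,0; 0,0,0,1]

/-- The special orthochronous Lorentz group SO⁺(1,3,ℝ) as a set of matrices. -/
def SOplus : Set (Matrix (Fin 4) (Fin 4) ℝ) :=
  {S | Sᵀ * etaMink * S = etaMink ∧ S.det = 1 ∧ 0 < S 0 0}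

/-- The defining relation of the full Lorentz group O(1,3,ℝ). -/
def IsLorentz (A : Matrix (Fin 4) (Fin 4) ℝ) : Prop :=
  Aᵀ * etaMink * A = etaMink

theorem etaMink_eq_diagonal : etaMink = diagonal ![1, -1, -1, -1] := by
  ext i j
  fin_cases i <;> fin_cases j <;> simp [etaMink]

theorem Pmat_eq_diagonal : Pmat = diagonal ![1, -1, -1, -1] :=
  etaMink_eq_diagonal

theorem Tmat_eq_diagonal : Tmat = diagonal ![-1, 1, 1, 1] := by
  ext i j
  fin_cases i <;> fin_cases j <;> simp [Tmat]

theorem det_etaMink : etaMink.det = -1 := by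
  simp [etaMink_eq_diagonal, Fin.prod_univ_four]

theorem det_Pmat : Pmat.det = -1 :=
  det_etaMink

theorem det_Tmat : Tmat.det = -1 := by
  simp [Tmat_eq_diagonal, Fin.prod_univ_four]

theorem Pmat_mul_self : Pmat * Pmat = 1 := by
  rw [Pmat_eq_diagonal, diagonal_mul_diagonal, diagonal_eq_one]
  ext i
  fin_cases i <;> simp

theorem Tmat_mul_self : Tmat * Tmat = 1 := by
  rw [Tmat_eq_diagonal, diagonal_mul_diagonal, diagonal_eq_one]
  ext i
  fin_cases i <;> simp

theorem isLorentz_Pmat : IsLorentz Pmat := by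
  have hP : etaMink = Pmat := rfl
  rw [IsLorentz, hP, mul_assoc, Pmat_mul_self, mul_one, Pmat_eq_diagonal, diagonal_transpose]

theorem isLorentz_Tmat : IsLorentz Tmat := by
  rw [IsLorentz, Tmat_eq_diagonal, etaMink_eq_diagonal, diagonal_transpose,
    diagonal_mul_diagonal, diagonal_mul_diagonal, diagonal_eq_diagonal_iff]
  intro i
  fin_cases i <;> simp

theorem IsLorentz.mul {A B : Matrix (Fin 4) (Fin 4) ℝ} (hA : IsLorentz A) (hB : IsLorentz B) :
    IsLorentz (A * B) := by
  unfold IsLorentz at *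
  calc (A * B)ᵀ * etaMink * (A * B) = Bᵀ * (Aᵀ * etaMink * A) * B := by
        simp only [transpose_mul, mul_assoc]
    _ = etaMink := by rw [hA, hB]

theorem isLorentz_neg {A : Matrix (Fin 4) (Fin 4) ℝ} : IsLorentz (-A) ↔ IsLorentz A := by
  simp [IsLorentz]

theorem IsLorentz.det_eq {A : Matrix (Fin 4) (Fin 4) ℝ} (hA : IsLorentz A) :
    A.det = 1 ∨ A.det = -1 := by
  have h := congrArg det hA
  rw [det_mul, det_mul, det_transpose, det_etaMink] at h
  exact mul_self_eq_one_iff.mp (by linarith)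

theorem IsLorentz.apply_zero_zero_ne_zero {A : Matrix (Fin 4) (Fin 4) ℝ} (hA : IsLorentz A) :
    A 0 0 ≠ 0 := by
  intro h0
  have h := congrFun (congrFun hA 0) 0
  simp [etaMink_eq_diagonal, mul_apply, Fin.sum_univ_four, diagonal_apply, h0] at h
  nlinarith [sq_nonneg (A 1 0), sq_nonneg (A 2 0), sq_nonneg (A 3 0)]

theorem mem_SOplus {A : Matrix (Fin 4) (Fin 4) ℝ} :
    A ∈ SOplus ↔ IsLorentz A ∧ A.det = 1 ∧ 0 < A 0 0 :=
  Iff.rfl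

theorem mem_mul_image_iff {Q A : Matrix (Fin 4) (Fin 4) ℝ} (hQQ : Q * Q = 1) :
    A ∈ (fun S => Q * S) '' SOplus ↔ Q * A ∈ SOplus := by
  constructor
  · rintro ⟨S, hS, rfl⟩
    simpa [← mul_assoc, hQQ] using hS
  · intro h
    exact ⟨Q * A, h, by simp [← mul_assoc, hQQ]⟩

theorem IsLorentz.mul_left_iff {Q A : Matrix (Fin 4) (Fin 4) ℝ} (hQ : IsLorentz Q)
    (hQQ : Q * Q = 1) : IsLorentz (Q * A) ↔ IsLorentz A :=
  ⟨fun h => by simpa [← mul_assoc, hQQ] using hQ.mul h, hQ.mul⟩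

theorem mem_Pmat_mul_SOplus {A : Matrix (Fin 4) (Fin 4) ℝ} :
    A ∈ (fun S => Pmat * S) '' SOplus ↔ IsLorentz A ∧ A.det = -1 ∧ 0 < A 0 0 := by
  have h : (Pmat * A) 0 0 = A 0 0 := by simp [Pmat_eq_diagonal, diagonal_mul]
  rw [mem_mul_image_iff Pmat_mul_self, mem_SOplus, isLorentz_Pmat.mul_left_iff Pmat_mul_self,
    det_mul, det_Pmat, h, neg_one_mul, neg_eq_iff_eq_neg]

theorem mem_Tmat_mul_SOplus {A : Matrix (Fin 4) (Fin 4) ℝ} :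
    A ∈ (fun S => Tmat * S) '' SOplus ↔ IsLorentz A ∧ A.det = -1 ∧ A 0 0 < 0 := by
  have h : (Tmat * A) 0 0 = -A 0 0 := by simp [Tmat_eq_diagonal, diagonal_mul]
  rw [mem_mul_image_iff Tmat_mul_self, mem_SOplus, isLorentz_Tmat.mul_left_iff Tmat_mul_self,
    det_mul, det_Tmat, h, neg_one_mul, neg_eq_iff_eq_neg, neg_pos]

theorem mem_neg_SOplus {A : Matrix (Fin 4) (Fin 4) ℝ} :
    A ∈ (fun S => -S) '' SOplus ↔ IsLorentz A ∧ A.det = 1 ∧ A 0 0 < 0 := by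
  have h : A ∈ (fun S => -S) '' SOplus ↔ -A ∈ SOplus := by simp
  rw [h, mem_SOplus, isLorentz_neg, det_neg, neg_apply, neg_pos]
  norm_num

/-- A matrix is a Lorentz matrix iff it belongs to exactly one of the four cosets
SO⁺(1,3,ℝ), P·SO⁺(1,3,ℝ), T·SO⁺(1,3,ℝ), -SO⁺(1,3,ℝ). -/
theorem stmt15 (A : Matrix (Fin 4) (Fin 4) ℝ) :
    Aᵀ * etaMink * A = etaMink ↔
      ∃! i : Fin 4,
        A ∈ (![SOplus,
               (fun S => Pmat * S) '' SOplus,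
               (fun S => Tmat * S) '' SOplus,
               (fun S => -S) '' SOplus] : Fin 4 → Set (Matrix (Fin 4) (Fin 4) ℝ)) i := by
  change IsLorentz A ↔ _
  constructor
  · intro hA
    rcases hA.det_eq with hd | hd <;>
      rcases hA.apply_zero_zero_ne_zero.lt_or_gt with h0 | h0
    on_goal 1 => refine ⟨3, mem_neg_SOplus.mpr ⟨hA, hd, h0⟩, ?_⟩
    on_goal 2 => refine ⟨0, mem_SOplus.mpr ⟨hA, hd, h0⟩, ?_⟩
    on_goal 3 => refine ⟨2, mem_Tmat_mul_SOplus.mpr ⟨hA, hd, h0⟩, ?_⟩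
    on_goal 4 => refine ⟨1, mem_Pmat_mul_SOplus.mpr ⟨hA, hd, h0⟩, ?_⟩
    all_goals
      intro j hj
      fin_cases j
      on_goal 1 => have hj' := mem_SOplus.mp hj
      on_goal 2 => have hj' := mem_Pmat_mul_SOplus.mp hj
      on_goal 3 => have hj' := mem_Tmat_mul_SOplus.mp hj
      on_goal 4 => have hj' := mem_neg_SOplus.mp hj
      all_goals first | rfl | (exfalso; linarith [hj'.2.1, hj'.2.2])
  · rintro ⟨j, hj, -⟩
    fin_cases j
    · exact (mem_SOplus.mp hj).1
    · exact (mem_Pmat_mul_SOplus.mp hj).1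
    · exact (mem_Tmat_mul_SOplus.mp hj).1
    · exact (mem_neg_SOplus.mp hj).1
end
end
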